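/- arXiv:1210.7773 — 2 statements merged into one kernel-verified Lean document; each statement's English description precedes it below -/
import Mathlib

section
/- The function ψ integrates to 1 over ℝ^k with respect to Lebesgue measure; consequently, the measure ν on ℝ^k with density ψ with respect to Lebesgue measure is a probability measure. -/
open Real MeasureTheory

/-- The density `ψ` of the measure `ν` on `ℝ^k`. -/
noncomputable def psi (k : ℕ) (x : Fin k → ℝ) : ℝ :=
  (2 * Real.pi) ^ (-(k : ℝ) / 2) *
    (1 + (∏ i, x i) * Real.exp (-(∑ i, x i ^ 2) / 2)) *
    Real.exp (-(∑ i, x i ^ 2) / 2)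

/-- The measure `ν` on `ℝ^k` with density `ψ` with respect to Lebesgue measure. -/
noncomputable def nu (k : ℕ) : Measure (Fin k → ℝ) :=
  (volume : Measure (Fin k → ℝ)).withDensity fun x => ENNReal.ofReal (psi k x)

theorem integral_mul_exp_neg_sq : ∫ t : ℝ, t * Real.exp (-t ^ 2) = 0 := by
  have h := integral_neg_eq_self (fun t : ℝ => t * Real.exp (-t ^ 2)) volume
  simp only [neg_sq, neg_mul, integral_neg] at h
  linarith

theorem abs_mul_exp_neg_sq_div_two_le_one (t : ℝ) : |t * Real.exp (-t ^ 2 / 2)| ≤ 1 := by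
  rw [abs_mul, Real.abs_exp, neg_div, Real.exp_neg, ← div_eq_mul_inv, div_le_one (Real.exp_pos _)]
  have h := Real.add_one_le_exp (t ^ 2 / 2)
  nlinarith [sq_nonneg (|t| - 1), sq_abs t]

theorem exp_neg_sum_sq_div_two {ι : Type*} [Fintype ι] (x : ι → ℝ) :
    Real.exp (-(∑ i, x i ^ 2) / 2) = ∏ i, Real.exp (-x i ^ 2 / 2) := by
  rw [← Real.exp_sum, ← Finset.sum_div, Finset.sum_neg_distrib]

theorem psi_nonneg (k : ℕ) (x : Fin k → ℝ) : 0 ≤ psi k x := by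
  unfold psi
  have h : |(∏ i, x i) * Real.exp (-(∑ i, x i ^ 2) / 2)| ≤ 1 := by
    rw [exp_neg_sum_sq_div_two, ← Finset.prod_mul_distrib, Finset.abs_prod]
    exact Finset.prod_le_one (fun _ _ => abs_nonneg _)
      fun i _ => abs_mul_exp_neg_sq_div_two_le_one (x i)
  have h' : 0 ≤ 1 + (∏ i, x i) * Real.exp (-(∑ i, x i ^ 2) / 2) := by
    linarith [(abs_le.mp h).1]
  positivity

theorem psi_eq_add (k : ℕ) (x : Fin k → ℝ) :
    psi k x = (2 * Real.pi) ^ (-(k : ℝ) / 2) *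
      (∏ i, Real.exp (-x i ^ 2 / 2) + ∏ i, x i * Real.exp (-x i ^ 2)) := by
  have h : ∏ i, Real.exp (-x i ^ 2) =
      (∏ i, Real.exp (-x i ^ 2 / 2)) * ∏ i, Real.exp (-x i ^ 2 / 2) := by
    rw [← Finset.prod_mul_distrib]
    refine Finset.prod_congr rfl fun i _ => ?_
    rw [← Real.exp_add, add_halves]
  rw [psi, exp_neg_sum_sq_div_two, Finset.prod_mul_distrib, h]
  ring

theorem integrable_prod_exp_neg_sq_div_two (k : ℕ) :
    Integrable fun x : Fin k → ℝ => ∏ i, Real.exp (-x i ^ 2 / 2) := by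
  refine Integrable.fintype_prod (f := fun _ : Fin k => fun t : ℝ => Real.exp (-t ^ 2 / 2))
    fun _ => ?_
  convert integrable_exp_neg_mul_sq (b := 1 / 2) (by norm_num) using 3
  ring

theorem integrable_prod_mul_exp_neg_sq (k : ℕ) :
    Integrable fun x : Fin k → ℝ => ∏ i, x i * Real.exp (-x i ^ 2) := by
  refine Integrable.fintype_prod (f := fun _ : Fin k => fun t : ℝ => t * Real.exp (-t ^ 2))
    fun _ => ?_
  simpa using integrable_mul_exp_neg_mul_sq (b := 1) one_pos

theorem integrable_psi (k : ℕ) : Integrable (psi k) := by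
  simp_rw [funext (psi_eq_add k)]
  exact ((integrable_prod_exp_neg_sq_div_two k).add
    (integrable_prod_mul_exp_neg_sq k)).const_mul _

theorem integral_psi {k : ℕ} (hk : k ≠ 0) : ∫ x : Fin k → ℝ, psi k x = 1 := by
  have hgauss : ∫ t : ℝ, Real.exp (-t ^ 2 / 2) = √(2 * π) := by
    convert integral_gaussian (1 / 2) using 2
    · ext t
      ring_nf
    · ring_nf
  simp_rw [psi_eq_add]
  rw [integral_const_mul, integral_add (integrable_prod_exp_neg_sq_div_two k)
      (integrable_prod_mul_exp_neg_sq k),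
    integral_fintype_prod_volume_eq_pow (ι := Fin k) (fun t : ℝ => Real.exp (-t ^ 2 / 2)),
    integral_fintype_prod_volume_eq_pow (ι := Fin k) (fun t : ℝ => t * Real.exp (-t ^ 2)),
    hgauss, integral_mul_exp_neg_sq, Fintype.card_fin, zero_pow hk, add_zero,
    Real.sqrt_eq_rpow, ← Real.rpow_mul_natCast (by positivity), ← Real.rpow_add (by positivity)]
  ring_nf
  exact Real.rpow_zero _

theorem integral_psi_eq_one_and_nu_isProbabilityMeasure (k : ℕ) (hk : 1 < k) :
    (∫ x : Fin k → ℝ, psi k x = 1) ∧ IsProbabilityMeasure (nu k) := by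
  have h := integral_psi (k := k) (by omega)
  refine ⟨h, ⟨?_⟩⟩
  rw [nu, withDensity_apply _ MeasurableSet.univ, Measure.restrict_univ,
    ← ofReal_integral_eq_lintegral_ofReal (integrable_psi k) (ae_of_all _ (psi_nonneg k)), h,
    ENNReal.ofReal_one]
end

section
/- For every integer k > 1 there exists a probability measure ν on ℝ^k which is not Gaussian but whose pushforward under every coordinate-deletion map ℝ^k → ℝ^{k-1} (omitting one coordinate) equals the (k-1)-fold product of standard Gaussian measures N(0,1); in particular every (k-1)-dimensional coordinate marginal of ν is Gaussian. -/
open Real MeasureTheory ProbabilityTheory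

/-- A measure on `ℝ^m` is Gaussian if its pushforward under every continuous
linear functional is a (possibly degenerate) one-dimensional Gaussian measure. -/
def IsGaussianMeasure {m : ℕ} (μ : Measure (Fin m → ℝ)) : Prop :=
  ∀ L : (Fin m → ℝ) →L[ℝ] ℝ, ∃ (a : ℝ) (v : NNReal), μ.map L = gaussianReal a v

/-- The map `ℝ^k → ℝ^(k-1)` deleting the `i`-th coordinate. -/
def deleteCoord (k : ℕ) (i : Fin k) (x : Fin k → ℝ) (j : Fin (k - 1)) : ℝ :=
  if h : (j : ℕ) < (i : ℕ) then x ⟨j, lt_trans h i.isLt⟩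
  else x ⟨(j : ℕ) + 1, by have := j.isLt; omega⟩

/-- A density with respect to the standard Gaussian measure on `ℝ^m` which doubles the orthants
where the product of the coordinates is positive and kills those where it is negative. -/
noncomputable def signProdDensity {m : ℕ} (x : Fin m → ℝ) : ENNReal :=
  if 0 < ∏ i, x i then 2 else if ∏ i, x i = 0 then 1 else 0

lemma measurable_signProdDensity {m : ℕ} : Measurable (signProdDensity (m := m)) := by
  have hp : Measurable fun x : Fin m → ℝ => ∏ i, x i := by fun_prop
  exact Measurable.ite (measurableSet_lt measurable_const hp) measurable_const
    (Measurable.ite (measurableSet_eq_fun hp measurable_const) measurable_const measurable_const)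

/-- The map changing the sign of the `i`-th coordinate. -/
def reflectCoord {m : ℕ} (i : Fin m) (x : Fin m → ℝ) (j : Fin m) : ℝ :=
  if j = i then -x j else x j

lemma prod_reflectCoord {m : ℕ} (i : Fin m) (x : Fin m → ℝ) :
    ∏ j, reflectCoord i x j = -∏ j, x j := by
  have h (j : Fin m) : reflectCoord i x j = (if j = i then -1 else 1) * x j := by
    unfold reflectCoord; split_ifs <;> simp
  simp_rw [h]
  rw [Finset.prod_mul_distrib, Finset.prod_ite_eq' Finset.univ i fun _ => (-1 : ℝ)]
  simp

lemma signProdDensity_add_reflectCoord {m : ℕ} (i : Fin m) (x : Fin m → ℝ) :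
    signProdDensity x + signProdDensity (reflectCoord i x) = 2 := by
  unfold signProdDensity
  rw [prod_reflectCoord]
  rcases lt_trichotomy (∏ j, x j) 0 with h | h | h
  · simp [h, h.ne, h.le]
  · simp [h, one_add_one_eq_two]
  · simp [h, h.ne', h.le]

lemma measurePreserving_reflectCoord {m : ℕ} (i : Fin m) :
    MeasurePreserving (reflectCoord i) (Measure.pi fun _ : Fin m => gaussianReal 0 1)
      (Measure.pi fun _ : Fin m => gaussianReal 0 1) := by
  refine measurePreserving_pi (fun _ : Fin m => gaussianReal 0 1) (fun _ => gaussianReal 0 1)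
    (f := fun j t => if j = i then -t else t) fun j => ?_
  by_cases h : j = i
  · simpa [h] using (⟨by fun_prop, by simp [gaussianReal_map_neg]⟩ :
      MeasurePreserving (fun t : ℝ => -t) (gaussianReal 0 1) (gaussianReal 0 1))
  · simp only [h, if_false]
    exact MeasurePreserving.id (gaussianReal 0 1)

lemma deleteCoord_succ {n : ℕ} (i : Fin (n + 1)) :
    deleteCoord (n + 1) i = fun x (j : Fin n) => x (i.succAbove j) := by
  ext x j
  unfold deleteCoord
  by_cases h : (j : ℕ) < i
  · rw [dif_pos h, Fin.succAbove_of_castSucc_lt _ _ (by simpa [Fin.lt_def] using h)]; rfl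
  · rw [dif_neg h, Fin.succAbove_of_le_castSucc _ _ (by simpa [Fin.le_def] using h)]; rfl

lemma measurePreserving_deleteCoord {n : ℕ} (i : Fin (n + 1)) :
    MeasurePreserving (deleteCoord (n + 1) i)
      (Measure.pi fun _ : Fin (n + 1) => gaussianReal 0 1)
      (Measure.pi fun _ : Fin n => gaussianReal 0 1) := by
  rw [deleteCoord_succ]
  exact measurePreserving_snd.comp
    (measurePreserving_piFinSuccAbove (fun _ : Fin (n + 1) => gaussianReal 0 1) i)

/-- The standard Gaussian measure on `ℝ^m` reweighted by `signProdDensity`. -/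
noncomputable def signProdMeasure (m : ℕ) : Measure (Fin m → ℝ) :=
  (Measure.pi fun _ : Fin m => gaussianReal 0 1).withDensity signProdDensity

lemma map_deleteCoord_signProdMeasure {n : ℕ} (i : Fin (n + 1)) :
    (signProdMeasure (n + 1)).map (deleteCoord (n + 1) i) =
      Measure.pi fun _ : Fin n => gaussianReal 0 1 := by
  have hd := measurePreserving_deleteCoord i
  have hr := measurePreserving_reflectCoord i
  refine Measure.ext fun s hs => ?_
  have hs' := hd.measurable hs
  rw [Measure.map_apply hd.measurable hs, signProdMeasure, withDensity_apply _ hs',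
    ← hd.measure_preimage hs.nullMeasurableSet]
  set γ := Measure.pi fun _ : Fin (n + 1) => gaussianReal 0 1
  set A := deleteCoord (n + 1) i ⁻¹' s
  have hA : reflectCoord i ⁻¹' A = A := by
    have : deleteCoord (n + 1) i ∘ reflectCoord i = deleteCoord (n + 1) i := by
      rw [deleteCoord_succ]
      ext x j
      simp [reflectCoord]
    change (deleteCoord (n + 1) i ∘ reflectCoord i) ⁻¹' s = A
    rw [this]
  have h1 : ∫⁻ x in A, signProdDensity (reflectCoord i x) ∂γ = ∫⁻ x in A, signProdDensity x ∂γ := by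
    conv_lhs => rw [← hA]
    exact hr.setLIntegral_comp_preimage hs' measurable_signProdDensity
  have h2 : 2 * ∫⁻ x in A, signProdDensity x ∂γ = 2 * γ A := by
    rw [two_mul]
    nth_rw 2 [← h1]
    rw [← lintegral_add_left measurable_signProdDensity]
    simp [signProdDensity_add_reflectCoord]
  exact (ENNReal.mul_right_inj two_ne_zero ENNReal.ofNat_ne_top).1 h2

lemma isProbabilityMeasure_signProdMeasure {n : ℕ} :
    IsProbabilityMeasure (signProdMeasure (n + 1)) := by
  have h : IsProbabilityMeasure ((signProdMeasure (n + 1)).map (deleteCoord (n + 1) 0)) := by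
    rw [map_deleteCoord_signProdMeasure]; infer_instance
  exact Measure.isProbabilityMeasure_of_map (deleteCoord (n + 1) 0)

instance isOpenPosMeasure_gaussianReal_zero_one : (gaussianReal 0 1).IsOpenPosMeasure :=
  (gaussianReal_absolutelyContinuous' 0 one_ne_zero).isOpenPosMeasure

lemma signProdMeasure_prod_neg (m : ℕ) : signProdMeasure m {x | ∏ i, x i < 0} = 0 := by
  rw [signProdMeasure, withDensity_apply_eq_zero measurable_signProdDensity]
  convert measure_empty (μ := Measure.pi fun _ : Fin m => gaussianReal 0 1)
  ext x
  simp only [signProdDensity, Set.mem_inter_iff, Set.mem_ofPred_eq, Set.mem_empty_iff_false,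
    iff_false, not_and]
  intro h1 h2
  simp [h2.ne, h2.le] at h1

lemma signProdMeasure_ne_zero_of_isOpen {m : ℕ} {U : Set (Fin m → ℝ)} (hU : IsOpen U)
    (hne : U.Nonempty) (hpos : ∀ x ∈ U, 0 < ∏ i, x i) : signProdMeasure m U ≠ 0 := by
  rw [signProdMeasure, Ne, withDensity_apply_eq_zero measurable_signProdDensity]
  have : {x | signProdDensity x ≠ 0} ∩ U = U :=
    Set.inter_eq_right.2 fun x hx => by simp [signProdDensity, hpos x hx]
  rw [this]
  exact hU.measure_ne_zero _ hne

lemma integral_eval_signProdMeasure {n : ℕ} (j : Fin (n + 2)) :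
    ∫ x, x j ∂(signProdMeasure (n + 2)) = 0 := by
  obtain ⟨i, hi⟩ := exists_ne j
  obtain ⟨l, rfl⟩ := Fin.exists_succAbove_eq hi.symm
  have hm := (measurePreserving_deleteCoord i).measurable
  have h := integral_map (μ := signProdMeasure (n + 2)) hm.aemeasurable
    (f := fun y : Fin (n + 1) → ℝ => y l) (measurable_pi_apply l).aestronglyMeasurable
  have h0 : ∫ y : Fin (n + 1) → ℝ, y l ∂(Measure.pi fun _ => gaussianReal 0 1) = 0 := by
    have := integral_comp_eval (μ := fun _ : Fin (n + 1) => gaussianReal 0 1) (i := l)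
      (f := fun t : ℝ => t) (by fun_prop)
    rw [this, integral_id_gaussianReal]
  have h' : ∫ y : Fin (n + 1) → ℝ, y l ∂((signProdMeasure (n + 2)).map (deleteCoord (n + 2) i))
      = 0 := by
    rw [map_deleteCoord_signProdMeasure]; exact h0
  rw [deleteCoord_succ] at h h'
  exact h.symm.trans h'

lemma not_isGaussian_signProdMeasure {n : ℕ} : ¬ IsGaussian (signProdMeasure (n + 2)) := by
  intro hG
  have hmean : (signProdMeasure (n + 2))[id] = 0 := by
    ext j
    rw [eval_integral fun i => ?_]
    · exact integral_eval_signProdMeasure j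
    · exact IsGaussian.integrable_dual (signProdMeasure (n + 2)) (ContinuousLinearMap.proj i)
  have hrot := IsGaussian.map_rotation_eq_self hmean (π / 4)
  set ν := signProdMeasure (n + 2)
  have hN : MeasurableSet {x : Fin (n + 2) → ℝ | ∏ i, x i < 0} :=
    measurableSet_lt (by fun_prop) measurable_const
  have hnull : (ν.prod ν) {p | ∏ i, (√2 / 2 * (p.1 i + p.2 i)) < 0} = 0 := by
    have h0 : (ν.prod ν) (Prod.fst ⁻¹' {x | ∏ i, x i < 0}) = 0 := by
      rw [← Set.prod_univ, Measure.prod_prod, signProdMeasure_prod_neg, zero_mul]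
    rw [← hrot, Measure.map_apply (by fun_prop) (measurable_fst hN)] at h0
    convert h0 using 2
    ext p
    simp [ContinuousLinearMap.rotation_apply, mul_add]
  let a : Fin (n + 2) → ℝ := Fin.cons 1 (Fin.cons 2 fun _ => 1)
  let b : Fin (n + 2) → ℝ := Fin.cons (-2) (Fin.cons (-1) fun _ => 1)
  let V : Set ((Fin (n + 2) → ℝ) × (Fin (n + 2) → ℝ)) :=
    {p | 0 < ∏ i, p.1 i} ∩ {p | 0 < ∏ i, p.2 i} ∩ {p | ∏ i, (√2 / 2 * (p.1 i + p.2 i)) < 0}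
  have hV : IsOpen V := by
    refine IsOpen.inter (IsOpen.inter ?_ ?_) ?_ <;>
      exact isOpen_lt (by fun_prop) (by fun_prop)
  have hab : (a, b) ∈ V := by
    refine ⟨⟨?_, ?_⟩, ?_⟩
    · simp [a, Fin.prod_univ_succ]
    · simp [b, Fin.prod_univ_succ]
    · simp only [Set.mem_ofPred_eq, Fin.prod_univ_succ, a, b, Fin.cons_zero, Fin.cons_succ,
        Finset.prod_const]
      have hs : 0 < √2 / 2 := by positivity
      have hq : 0 < (√2 / 2 * (1 + 1)) ^ (Finset.univ : Finset (Fin n)).card := by positivity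
      have h1 : √2 / 2 * (1 + -2) < 0 := by linarith
      have h2 : 0 < √2 / 2 * (2 + -1) := by linarith
      exact mul_neg_of_neg_of_pos h1 (mul_pos h2 hq)
  obtain ⟨U, W, hU, hW, ha, hb, hUW⟩ := isOpen_prod_iff.1 hV a b hab
  have hzero : ν U * ν W = 0 := by
    rw [← Measure.prod_prod]
    exact measure_mono_null (fun p hp => (hUW hp).2) hnull
  refine mul_ne_zero (signProdMeasure_ne_zero_of_isOpen hU ⟨a, ha⟩ fun x hx => ?_)
    (signProdMeasure_ne_zero_of_isOpen hW ⟨b, hb⟩ fun y hy => ?_) hzero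
  · exact (hUW (Set.mk_mem_prod hx hb)).1.1
  · exact (hUW (Set.mk_mem_prod ha hy)).1.2

/-- For every `k > 1` there is a nongaussian probability measure on `ℝ^k` all of
whose `(k-1)`-dimensional coordinate marginals are i.i.d. standard Gaussian. -/
theorem exists_nongaussian_with_gaussian_marginals (k : ℕ) (hk : 1 < k) :
    ∃ ν : Measure (Fin k → ℝ), IsProbabilityMeasure ν ∧
      ¬ IsGaussianMeasure ν ∧
      ∀ i : Fin k, ν.map (deleteCoord k i) =
        Measure.pi (fun _ : Fin (k - 1) => gaussianReal 0 1) := by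
  obtain ⟨n, rfl⟩ : ∃ n, k = n + 2 := ⟨k - 2, by omega⟩
  exact ⟨signProdMeasure (n + 2), isProbabilityMeasure_signProdMeasure,
    fun h => not_isGaussian_signProdMeasure (isGaussian_of_map_eq_gaussianReal h),
    fun i => map_deleteCoord_signProdMeasure i⟩
end
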